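/- Let α be a set and let F, F' be classes of functions α → [−1, 1] with pseudo-dimensions at most d_F and d_{F'} respectively, where d_F, d_{F'} ≥ 1. Then the class F ⊖ F' = { x ↦ min(f(x), f'(x)) : f ∈ F, f' ∈ F' } has pseudo-dimension strictly less than 3 (1 + ln(d_F · d_{F'})) (d_F + d_{F'}). -/

import Mathlib

/-- A class `H` of real-valued functions P-shatters the points `pts 0, …, pts (N-1)`
if there are thresholds `γ i` such that every above/below pattern is realized. -/
def PShatters {Z : Type*} (H : Set (Z → ℝ)) {N : ℕ} (pts : Fin N → Z) : Prop :=
  ∃ γ : Fin N → ℝ, ∀ T : Finset (Fin N), ∃ h ∈ H, ∀ i : Fin N, γ i ≤ h (pts i) ↔ i ∈ T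

open Classical in
/-- The above/below patterns that a class `H` realizes on `pts` at the thresholds `γ`. -/
noncomputable def aboveTraces {Z : Type*} (H : Set (Z → ℝ)) {N : ℕ} (pts : Fin N → Z)
    (γ : Fin N → ℝ) : Finset (Finset (Fin N)) :=
  Finset.univ.filter fun T => ∃ h ∈ H, ∀ i, γ i ≤ h (pts i) ↔ i ∈ T

theorem mem_aboveTraces {Z : Type*} {H : Set (Z → ℝ)} {N : ℕ} {pts : Fin N → Z}
    {γ : Fin N → ℝ} {T : Finset (Fin N)} :
    T ∈ aboveTraces H pts γ ↔ ∃ h ∈ H, ∀ i, γ i ≤ h (pts i) ↔ i ∈ T := by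
  simp [aboveTraces]

theorem pShatters_of_shatters_aboveTraces {Z : Type*} {H : Set (Z → ℝ)} {N : ℕ}
    {pts : Fin N → Z} {γ : Fin N → ℝ} {s : Finset (Fin N)}
    (hs : (aboveTraces H pts γ).Shatters s) :
    PShatters H (pts ∘ s.orderEmbOfFin rfl) := by
  refine ⟨γ ∘ s.orderEmbOfFin rfl, fun T => ?_⟩
  obtain ⟨u, hu, hsu⟩ := hs (t := T.map (s.orderEmbOfFin rfl).toEmbedding) (by
    intro x hx
    obtain ⟨i, -, rfl⟩ := Finset.mem_map.1 hx
    exact s.orderEmbOfFin_mem rfl i)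
  obtain ⟨h, hH, hh⟩ := mem_aboveTraces.1 hu
  refine ⟨h, hH, fun i => ?_⟩
  have hi := s.orderEmbOfFin_mem rfl i
  have key := Finset.ext_iff.1 hsu (s.orderEmbOfFin rfl i)
  simp only [Finset.mem_inter, hi, true_and, Finset.mem_map, RelEmbedding.coe_toEmbedding,
    EmbeddingLike.apply_eq_iff_eq, exists_eq_right] at key
  exact (hh _).trans key

/-- The Sauer–Shelah bound for classes of pseudo-dimension at most `d`. -/
theorem card_aboveTraces_le {Z : Type*} {H : Set (Z → ℝ)} {d : ℕ}
    (hH : ∀ N : ℕ, d < N → ∀ pts : Fin N → Z, ¬ PShatters H pts) {N : ℕ}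
    (pts : Fin N → Z) (γ : Fin N → ℝ) :
    (aboveTraces H pts γ).card ≤ ∑ k ∈ Finset.Iic d, N.choose k := by
  have hvc : (aboveTraces H pts γ).vcDim ≤ d := by
    refine Finset.sup_le fun s hs => ?_
    by_contra! hlt
    exact hH _ hlt _ (pShatters_of_shatters_aboveTraces (Finset.mem_shatterer.1 hs))
  calc (aboveTraces H pts γ).card
      ≤ (aboveTraces H pts γ).shatterer.card := Finset.card_le_card_shatterer _
    _ ≤ ∑ k ∈ Finset.Iic (aboveTraces H pts γ).vcDim, N.choose k := by
      simpa using Finset.card_shatterer_le_sum_vcDim (𝒜 := aboveTraces H pts γ)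
    _ ≤ ∑ k ∈ Finset.Iic d, N.choose k :=
      Finset.sum_le_sum_of_subset (Finset.Iic_subset_Iic.2 hvc)

theorem two_pow_le_card_aboveTraces_mul {Z : Type*} {F F' : Set (Z → ℝ)} {N : ℕ}
    {pts : Fin N → Z} {γ : Fin N → ℝ}
    (hγ : ∀ T : Finset (Fin N), ∃ h ∈ {h | ∃ f ∈ F, ∃ f' ∈ F', h = fun x => min (f x) (f' x)},
      ∀ i, γ i ≤ h (pts i) ↔ i ∈ T) :
    2 ^ N ≤ (aboveTraces F pts γ).card * (aboveTraces F' pts γ).card := by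
  classical
  have hsub : (Finset.univ : Finset (Finset (Fin N))) ⊆
      (aboveTraces F pts γ ×ˢ aboveTraces F' pts γ).image fun p => p.1 ∩ p.2 := by
    intro T _
    obtain ⟨_, ⟨f, hf, f', hf', rfl⟩, hT⟩ := hγ T
    refine Finset.mem_image.2 ⟨(Finset.univ.filter fun i => γ i ≤ f (pts i),
      Finset.univ.filter fun i => γ i ≤ f' (pts i)), Finset.mem_product.2
        ⟨mem_aboveTraces.2 ⟨f, hf, by simp⟩, mem_aboveTraces.2 ⟨f', hf', by simp⟩⟩, ?_⟩
    ext i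
    simp [← hT i]
  simpa using (Finset.card_le_card hsub).trans Finset.card_image_le

theorem pow_mul_sum_choose_le {x : ℝ} (hx0 : 0 ≤ x) (hx1 : x ≤ 1) (N d : ℕ) :
    x ^ d * ∑ k ∈ Finset.Iic d, (N.choose k : ℝ) ≤ (1 + x) ^ N := by
  calc x ^ d * ∑ k ∈ Finset.Iic d, (N.choose k : ℝ)
      ≤ ∑ k ∈ Finset.Iic d, x ^ k * N.choose k := by
        rw [Finset.mul_sum]
        refine Finset.sum_le_sum fun k hk => ?_
        exact mul_le_mul_of_nonneg_right
          (pow_le_pow_of_le_one hx0 hx1 (Finset.mem_Iic.1 hk)) (Nat.cast_nonneg _)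
    _ ≤ ∑ k ∈ Finset.range (N + d + 1), x ^ k * N.choose k := by
        refine Finset.sum_le_sum_of_subset_of_nonneg (fun k hk => ?_) fun _ _ _ => by positivity
        have := Finset.mem_Iic.1 hk
        exact Finset.mem_range.2 (by omega)
    _ = ∑ k ∈ Finset.range (N + 1), x ^ k * N.choose k := by
        refine (Finset.sum_subset (Finset.range_subset_range.2 (by omega)) fun k _ hk => ?_).symm
        rw [Nat.choose_eq_zero_of_lt (by simpa using hk)]
        simp
    _ = (1 + x) ^ N := by
        rw [add_comm 1 x, add_pow]
        simp

theorem sum_choose_mul_sum_choose_lt_two_pow {a b N : ℕ} (hab : 0 < a + b)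
    (hN : 5 * (a + b) ≤ N) :
    (∑ k ∈ Finset.Iic a, N.choose k) * (∑ k ∈ Finset.Iic b, N.choose k) < 2 ^ N := by
  have ha := pow_mul_sum_choose_le (x := 1 / 8) (by norm_num) (by norm_num) N a
  have hb := pow_mul_sum_choose_le (x := 1 / 8) (by norm_num) (by norm_num) N b
  have hmul := mul_le_mul ha hb (by positivity) (by positivity)
  have hpow : (8 : ℝ) ^ (a + b) < (128 / 81) ^ N :=
    calc (8 : ℝ) ^ (a + b) < ((128 / 81) ^ 5) ^ (a + b) :=
          pow_lt_pow_left₀ (by norm_num) (by norm_num) hab.ne'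
      _ = (128 / 81) ^ (5 * (a + b)) := (pow_mul _ _ _).symm
      _ ≤ (128 / 81) ^ N := pow_le_pow_right₀ (by norm_num) hN
  have hreal : (∑ k ∈ Finset.Iic a, (N.choose k : ℝ)) * (∑ k ∈ Finset.Iic b, (N.choose k : ℝ))
      < 2 ^ N :=
    calc (∑ k ∈ Finset.Iic a, (N.choose k : ℝ)) * (∑ k ∈ Finset.Iic b, (N.choose k : ℝ))
        = 8 ^ (a + b) * (((1 / 8) ^ a * ∑ k ∈ Finset.Iic a, (N.choose k : ℝ)) *
          ((1 / 8) ^ b * ∑ k ∈ Finset.Iic b, (N.choose k : ℝ))) := by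
          simp only [one_div, inv_pow, pow_add]
          field_simp
      _ ≤ 8 ^ (a + b) * ((1 + 1 / 8) ^ N * (1 + 1 / 8) ^ N) := by gcongr
      _ < (128 / 81) ^ N * ((1 + 1 / 8) ^ N * (1 + 1 / 8) ^ N) := by gcongr
      _ = 2 ^ N := by
          rw [← mul_pow, ← mul_pow]
          norm_num
  exact_mod_cast hreal

theorem succ_sq_lt_two_pow {N : ℕ} (hN : 6 ≤ N) : (N + 1) * (N + 1) < 2 ^ N := by
  induction N, hN using Nat.le_induction with
  | base => norm_num
  | succ n hn ih =>
    rw [pow_succ]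
    nlinarith

/-- if `F` and `F'` map into `[−1, 1]` with pseudo-dimensions at most
`d_F ≥ 1` and `d_{F'} ≥ 1`, then the pointwise-minimum class
`F ⊖ F' = {x ↦ min(f(x), f'(x))}` has pseudo-dimension strictly less than
`3 (1 + ln(d_F·d_{F'})) (d_F + d_{F'})`. -/
theorem pdim_min_lt {α : Type*} (F F' : Set (α → ℝ)) (dF dF' : ℕ)
    (hdF : 1 ≤ dF) (hdF' : 1 ≤ dF')
    (hFrange : ∀ f ∈ F, ∀ x, f x ∈ Set.Icc (-1 : ℝ) 1)
    (hF'range : ∀ f ∈ F', ∀ x, f x ∈ Set.Icc (-1 : ℝ) 1)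
    (hF : ∀ N : ℕ, dF < N → ∀ pts : Fin N → α, ¬ PShatters F pts)
    (hF' : ∀ N : ℕ, dF' < N → ∀ pts : Fin N → α, ¬ PShatters F' pts) :
    ∀ N : ℕ, 3 * (1 + Real.log ((dF : ℝ) * (dF' : ℝ))) * ((dF : ℝ) + (dF' : ℝ)) ≤ (N : ℝ) →
      ∀ pts : Fin N → α,
        ¬ PShatters {h | ∃ f ∈ F, ∃ f' ∈ F', h = fun x => min (f x) (f' x)} pts := by
  rintro N hN pts ⟨γ, hγ⟩
  have hle : 2 ^ N ≤ (∑ k ∈ Finset.Iic dF, N.choose k) * (∑ k ∈ Finset.Iic dF', N.choose k) :=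
    (two_pow_le_card_aboveTraces_mul hγ).trans
      (Nat.mul_le_mul (card_aboveTraces_le hF pts γ) (card_aboveTraces_le hF' pts γ))
  refine hle.not_gt ?_
  by_cases h1 : dF * dF' = 1
  · obtain ⟨rfl, rfl⟩ := mul_eq_one.1 h1
    have hN6 : 6 ≤ N := by
      norm_num at hN
      exact_mod_cast hN
    have hsum : ∑ k ∈ Finset.Iic 1, N.choose k = N + 1 := by
      rw [show Finset.Iic 1 = Finset.range 2 from rfl]
      simp [Finset.sum_range_succ, add_comm]
    rw [hsum]
    exact succ_sq_lt_two_pow hN6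
  · refine sum_choose_mul_sum_choose_lt_two_pow (by omega) ?_
    have h2 : 2 ≤ dF * dF' := by
      have := Nat.mul_pos hdF hdF'
      omega
    have hlog : Real.log 2 ≤ Real.log ((dF : ℝ) * dF') :=
      Real.log_le_log (by norm_num) (by exact_mod_cast h2)
    have hlog2 := Real.log_two_gt_d9
    have hs : (0 : ℝ) ≤ (dF : ℝ) + dF' := by positivity
    have : 5 * ((dF : ℝ) + dF') ≤ N := le_trans
      (mul_le_mul_of_nonneg_right (by linarith) hs) hN
    exact_mod_cast this
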